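/- arXiv:1909.02429 — 2 statements merged into one kernel-verified Lean document; each statement's English description precedes it below -/
import Mathlib

section
/- For every s ∈ (0,1) and every r > 0, the derivative of the Bessel quotient is given by the Wronskian identity d/dr [ I_{1−s}(r)/I_{s−1}(r) ] = 2 sin(πs) / (π · r · I_{s−1}(r)²). In particular this derivative is strictly positive for all r > 0. -/
open MeasureTheory Filter

/-- Modified Bessel function of the first kind, defined by its power series. -/
noncomputable def besselI (ν x : ℝ) : ℝ :=
  ∑' k : ℕ, (x / 2) ^ (2 * (k : ℝ) + ν) / ((k.factorial : ℝ) * Real.Gamma ((k : ℝ) + ν + 1))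

/-- The general term of the entire function attached to `besselI μ`. -/
noncomputable def besselEntireTerm (μ z : ℝ) (k : ℕ) : ℝ :=
  z ^ k / ((k.factorial : ℝ) * Real.Gamma ((k : ℝ) + μ + 1))

/-- The entire function `F_μ` with `besselI μ x = (x / 2) ^ μ * F_μ ((x / 2) ^ 2)`. -/
noncomputable def besselEntire (μ z : ℝ) : ℝ :=
  ∑' k : ℕ, besselEntireTerm μ z k

theorem Gamma_natCast_add_pos {μ : ℝ} (hμ : -1 < μ) (k : ℕ) :
    0 < Real.Gamma ((k : ℝ) + μ + 1) := by
  have := k.cast_nonneg (α := ℝ)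
  exact Real.Gamma_pos_of_pos (by linarith)

theorem besselEntireTerm_succ {μ : ℝ} (hμ : -1 < μ) (z : ℝ) (k : ℕ) :
    besselEntireTerm μ z (k + 1) =
      z / (((k : ℝ) + 1) * ((k : ℝ) + μ + 1)) * besselEntireTerm μ z k := by
  have hk := k.cast_nonneg (α := ℝ)
  have hpos : 0 < (k : ℝ) + μ + 1 := by linarith
  have hΓ := Gamma_natCast_add_pos hμ k
  have hfac : (0 : ℝ) < k.factorial := by positivity
  have hrec : Real.Gamma (((k + 1 : ℕ) : ℝ) + μ + 1)
      = ((k : ℝ) + μ + 1) * Real.Gamma ((k : ℝ) + μ + 1) := by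
    rw [← Real.Gamma_add_one hpos.ne']
    push_cast
    ring_nf
  rw [besselEntireTerm, besselEntireTerm, hrec, Nat.factorial_succ]
  push_cast
  field_simp
  ring

theorem summable_besselEntireTerm {μ : ℝ} (hμ : -1 < μ) (z : ℝ) :
    Summable (besselEntireTerm μ z) := by
  refine summable_of_ratio_norm_eventually_le (r := 1 / 2) (by norm_num) ?_
  obtain ⟨N, hN⟩ := exists_nat_ge (2 * |z|)
  filter_upwards [eventually_ge_atTop (max N 1)] with k hk
  have hNk : (N : ℝ) ≤ k := by exact_mod_cast (le_max_left _ _).trans hk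
  have hk1 : (1 : ℝ) ≤ k := by exact_mod_cast (le_max_right _ _).trans hk
  rw [besselEntireTerm_succ hμ, norm_mul]
  refine mul_le_mul_of_nonneg_right ?_ (norm_nonneg _)
  have hpos : 0 < ((k : ℝ) + 1) * ((k : ℝ) + μ + 1) := mul_pos (by linarith) (by linarith)
  rw [norm_div, Real.norm_eq_abs, Real.norm_eq_abs, abs_of_pos hpos, div_le_iff₀ hpos]
  nlinarith

theorem besselEntire_pos {μ z : ℝ} (hμ : -1 < μ) (hz : 0 ≤ z) : 0 < besselEntire μ z := by
  refine (summable_besselEntireTerm hμ z).tsum_pos (fun k => ?_) 0 ?_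
  · have := Gamma_natCast_add_pos hμ k
    unfold besselEntireTerm
    positivity
  · have := Gamma_natCast_add_pos hμ 0
    unfold besselEntireTerm
    positivity

theorem besselEntire_zero (μ : ℝ) : besselEntire μ 0 = 1 / Real.Gamma (μ + 1) := by
  rw [besselEntire, tsum_eq_single 0]
  · simp [besselEntireTerm]
  · intro k hk
    simp [besselEntireTerm, hk]

theorem hasDerivAt_besselEntire {μ : ℝ} (hμ : -1 < μ) (z : ℝ) :
    HasDerivAt (besselEntire μ) (besselEntire (μ + 1) z) z := by
  let g' : ℕ → ℝ → ℝ := fun k y =>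
    (k : ℝ) * y ^ (k - 1) / ((k.factorial : ℝ) * Real.Gamma ((k : ℝ) + μ + 1))
  have hg'succ (k : ℕ) (y : ℝ) : g' (k + 1) y = besselEntireTerm (μ + 1) y k := by
    have hΓ := Gamma_natCast_add_pos hμ (k + 1)
    have harg : (k : ℝ) + (μ + 1) + 1 = ((k + 1 : ℕ) : ℝ) + μ + 1 := by push_cast; ring
    simp only [g', besselEntireTerm]
    rw [harg, Nat.factorial_succ, Nat.add_sub_cancel]
    push_cast at hΓ ⊢
    field_simp
  have hsum (y : ℝ) : Summable fun k => g' k y := by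
    rw [← summable_nat_add_iff 1]
    simpa only [hg'succ] using summable_besselEntireTerm (by linarith : -1 < μ + 1) y
  have hz : z ∈ Metric.ball (0 : ℝ) (|z| + 1) := by simp
  have key := hasDerivAt_tsum_of_isPreconnected (g := fun k y => besselEntireTerm μ y k)
    (hsum (|z| + 1)) Metric.isOpen_ball
    (convex_ball (0 : ℝ) (|z| + 1)).isPreconnected (g' := g')
    (fun k y _ => (hasDerivAt_pow k y).div_const _) (fun k y hy => ?_) hz
    (summable_besselEntireTerm hμ z) hz
  · refine key.congr_deriv ?_
    rw [(hsum z).tsum_eq_zero_add]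
    simp only [hg'succ]
    simp [besselEntire, g']
  · have hΓ := Gamma_natCast_add_pos hμ k
    have hy' : |y| ≤ |z| + 1 := by simpa using (mem_ball_zero_iff.mp hy).le
    have hden : 0 < (k.factorial : ℝ) * Real.Gamma ((k : ℝ) + μ + 1) := by positivity
    simp only [g']
    rw [norm_div, norm_mul, norm_pow, Real.norm_of_nonneg hden.le, Real.norm_natCast,
      Real.norm_eq_abs]
    gcongr

/-- The three-term recurrence `F_{μ-1} = μ F_μ + z F_{μ+1}`. -/
theorem besselEntire_recurrence {μ : ℝ} (hμ : 0 < μ) (z : ℝ) :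
    besselEntire (μ - 1) z = μ * besselEntire μ z + z * besselEntire (μ + 1) z := by
  have h₀ := summable_besselEntireTerm (by linarith : -1 < μ - 1) z
  have h₁ := summable_besselEntireTerm (by linarith : -1 < μ) z
  have hzero : besselEntireTerm (μ - 1) z 0 = μ * besselEntireTerm μ z 0 := by
    have hΓ := Real.Gamma_pos_of_pos hμ
    simp [besselEntireTerm, Real.Gamma_add_one hμ.ne']
    field_simp
  have hsucc (k : ℕ) : besselEntireTerm (μ - 1) z (k + 1) =
      μ * besselEntireTerm μ z (k + 1) + z * besselEntireTerm (μ + 1) z k := by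
    have hk := k.cast_nonneg (α := ℝ)
    have hpos : 0 < (k : ℝ) + μ + 1 := by linarith
    have hΓ := Real.Gamma_pos_of_pos hpos
    have e₁ : ((k + 1 : ℕ) : ℝ) + (μ - 1) + 1 = (k : ℝ) + μ + 1 := by push_cast; ring
    have e₂ : ((k + 1 : ℕ) : ℝ) + μ + 1 = ((k : ℝ) + μ + 1) + 1 := by push_cast; ring
    have e₃ : (k : ℝ) + (μ + 1) + 1 = ((k : ℝ) + μ + 1) + 1 := by ring
    simp only [besselEntireTerm]
    rw [e₁, e₂, e₃, Real.Gamma_add_one hpos.ne', Nat.factorial_succ]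
    push_cast
    field_simp
    ring
  simp only [besselEntire]
  rw [h₀.tsum_eq_zero_add, h₁.tsum_eq_zero_add, hzero]
  simp only [hsucc]
  rw [((summable_nat_add_iff 1).mpr h₁ |>.mul_left μ).tsum_add
    ((summable_besselEntireTerm (by linarith) z).mul_left z), tsum_mul_left, tsum_mul_left]
  ring

theorem besselEntire_wronskian {ν : ℝ} (hν : ν ∈ Set.Ioo (0 : ℝ) 1) (z : ℝ) :
    besselEntire (ν - 1) z * besselEntire (-ν) z
      - z * (besselEntire ν z * besselEntire (1 - ν) z) = Real.sin (Real.pi * ν) / Real.pi := by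
  obtain ⟨h0, h1⟩ := hν
  have hderiv (y : ℝ) : HasDerivAt (fun z => besselEntire (ν - 1) z * besselEntire (-ν) z
      - z * (besselEntire ν z * besselEntire (1 - ν) z)) 0 y := by
    have d₁ := hasDerivAt_besselEntire (by linarith : -1 < ν - 1) y
    have d₂ := hasDerivAt_besselEntire (by linarith : -1 < -ν) y
    have d₃ := hasDerivAt_besselEntire (by linarith : -1 < ν) y
    have d₄ := hasDerivAt_besselEntire (by linarith : -1 < 1 - ν) y
    have r₁ := besselEntire_recurrence h0 y
    have r₂ := besselEntire_recurrence (by linarith : 0 < 1 - ν) y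
    rw [show 1 - ν - 1 = -ν by ring] at r₂
    rw [show ν - 1 + 1 = ν by ring] at d₁
    rw [show -ν + 1 = 1 - ν by ring] at d₂
    refine ((d₁.mul d₂).sub ((hasDerivAt_id y).mul (d₃.mul d₄))).congr_deriv ?_
    simp only [id, Pi.mul_apply, r₁, r₂]
    ring
  have hconst := is_const_of_deriv_eq_zero (fun y => (hderiv y).differentiableAt)
    (fun y => (hderiv y).deriv) z 0
  rw [hconst, besselEntire_zero, besselEntire_zero, zero_mul, sub_zero,
    show ν - 1 + 1 = ν by ring, show -ν + 1 = 1 - ν by ring, div_mul_div_comm, one_mul,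
    Real.Gamma_mul_Gamma_one_sub, one_div_div]

theorem besselI_eq (ν : ℝ) {x : ℝ} (hx : 0 < x) :
    besselI ν x = (x / 2) ^ ν * besselEntire ν ((x / 2) ^ 2) := by
  rw [besselI, besselEntire, ← tsum_mul_left]
  congr 1 with k
  have hx2 : 0 < x / 2 := by positivity
  rw [besselEntireTerm, Real.rpow_add hx2, ← pow_mul,
    show 2 * (k : ℝ) = ((2 * k : ℕ) : ℝ) by push_cast; ring, Real.rpow_natCast]
  ring

theorem hasDerivAt_besselI_div_besselI_neg {ν : ℝ} (hν : ν ∈ Set.Ioo (0 : ℝ) 1) {r : ℝ}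
    (hr : 0 < r) :
    HasDerivAt (fun t : ℝ => besselI ν t / besselI (-ν) t)
      (2 * Real.sin (Real.pi * ν) / (Real.pi * r * (besselI (-ν) r) ^ 2)) r := by
  have hr2 : 0 < r / 2 := by positivity
  have hν1 : -1 < -ν := by linarith [hν.2]
  have hF := besselEntire_pos hν1 (sq_nonneg (r / 2))
  have hP := Real.rpow_pos_of_pos hr2 ν
  have heq : (fun t : ℝ => besselI ν t / besselI (-ν) t) =ᶠ[nhds r] fun t =>
      (t / 2) ^ (2 * ν) * (besselEntire ν ((t / 2) ^ 2) / besselEntire (-ν) ((t / 2) ^ 2)) := by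
    filter_upwards [lt_mem_nhds hr] with t ht
    have ht2 : 0 < t / 2 := by positivity
    have := besselEntire_pos hν1 (sq_nonneg (t / 2))
    have := Real.rpow_pos_of_pos ht2 ν
    rw [besselI_eq _ ht, besselI_eq _ ht, Real.rpow_neg ht2.le, two_mul, Real.rpow_add ht2]
    field_simp
  have dhalf : HasDerivAt (fun t : ℝ => t / 2) (1 / 2) r := (hasDerivAt_id r).div_const 2
  have dsq : HasDerivAt (fun t : ℝ => (t / 2) ^ 2) (r / 2) r :=
    (dhalf.pow 2).congr_deriv (by norm_num; ring)
  have dpow := dhalf.rpow_const (p := 2 * ν) (Or.inl hr2.ne')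
  have d₁ := (hasDerivAt_besselEntire (by linarith [hν.1] : -1 < ν) ((r / 2) ^ 2)).comp r dsq
  have d₂ := (hasDerivAt_besselEntire hν1 ((r / 2) ^ 2)).comp r dsq
  refine ((dpow.mul (d₁.div d₂ hF.ne')).congr_of_eventuallyEq heq).congr_deriv ?_
  have W := besselEntire_wronskian hν ((r / 2) ^ 2)
  rw [besselEntire_recurrence hν.1] at W
  have hsin : Real.sin (Real.pi * ν) = Real.pi * (Real.sin (Real.pi * ν) / Real.pi) := by
    field_simp
  rw [hsin, ← W, besselI_eq _ hr, Real.rpow_neg hr2.le, Real.rpow_sub_one hr2.ne', two_mul,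
    Real.rpow_add hr2, show -ν + 1 = 1 - ν by ring]
  simp only [Function.comp_apply, Pi.div_apply]
  have hπ := Real.pi_pos
  generalize (r / 2) ^ ν = P at *
  generalize besselEntire (-ν) ((r / 2) ^ 2) = A at *
  generalize besselEntire ν ((r / 2) ^ 2) = B at *
  generalize besselEntire (1 - ν) ((r / 2) ^ 2) = C at *
  generalize besselEntire (ν + 1) ((r / 2) ^ 2) = D at *
  field_simp
  ring

/-- Wronskian identity for the derivative of the Bessel quotient, and its positivity. -/
theorem stmt4 (s : ℝ) (hs : s ∈ Set.Ioo (0 : ℝ) 1) (r : ℝ) (hr : 0 < r) :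
    HasDerivAt (fun t : ℝ => besselI (1 - s) t / besselI (s - 1) t)
      (2 * Real.sin (Real.pi * s) / (Real.pi * r * (besselI (s - 1) r) ^ 2)) r ∧
    0 < 2 * Real.sin (Real.pi * s) / (Real.pi * r * (besselI (s - 1) r) ^ 2) := by
  obtain ⟨h0, h1⟩ := hs
  constructor
  · have h := hasDerivAt_besselI_div_besselI_neg (ν := 1 - s)
      ⟨by linarith, by linarith⟩ hr
    rwa [neg_sub, show Real.pi * (1 - s) = Real.pi - Real.pi * s by ring,
      Real.sin_pi_sub] at h
  · have hsin : 0 < Real.sin (Real.pi * s) :=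
      Real.sin_pos_of_pos_of_lt_pi (by positivity) (by nlinarith [Real.pi_pos])
    have hI : 0 < besselI (s - 1) r := by
      rw [besselI_eq _ hr]
      have := besselEntire_pos (by linarith : -1 < s - 1) (sq_nonneg (r / 2))
      positivity
    positivity
end

section
/- (Proposition 1.4, behavior at 0) Let s ∈ (0,1/2) and define, in dimension n = 1, T_s(r) := ∫_ℝ S_s(ξ) · 4 sin²(rξ)/ξ² dξ for r > 0. Then T_s(r)/r^{1−2s} → 4 C_s ∫_ℝ sin²(η)/|η|^{2−2s} dη as r → 0⁺, and this limit is a finite positive constant depending only on s. In particular, for small r the quantity T_s(r) behaves like the fractional s-perimeter r^{1−2s} of an interval of length r. -/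
open MeasureTheory Filter

noncomputable def Cs (s : ℝ) : ℝ := (2 : ℝ) ^ (1 - 2 * s) * Real.Gamma (1 - s) / Real.Gamma s

open Classical in
/-- The rescaled symbol `S̃_s` in dimension one. -/
noncomputable def Stilde1 (s ξ : ℝ) : ℝ :=
  if ξ = 0 then 0 else Cs s * besselI (1 - s) |ξ| / besselI (s - 1) |ξ|

/-- The Dirichlet-to-Neumann symbol `S_s(ξ) = |ξ|^{2s} S̃_s(ξ)` in dimension one. -/
noncomputable def symbolS1 (s ξ : ℝ) : ℝ := |ξ| ^ (2 * s) * Stilde1 s ξ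

/-- `T_s(r) = ∫_ℝ S_s(ξ) · 4 sin²(rξ)/ξ² dξ`, the value of the limit functional on the
indicator of an interval of length `2r`. -/
noncomputable def Ts (s r : ℝ) : ℝ :=
  ∫ ξ : ℝ, symbolS1 s ξ * (4 * (Real.sin (r * ξ)) ^ 2 / ξ ^ 2)

/-- The `k`-th term of the series of `I_ν(2t)`. -/
noncomputable def besselTerm (ν t : ℝ) (k : ℕ) : ℝ :=
  t ^ (2 * (k : ℝ) + ν) / ((k.factorial : ℝ) * Real.Gamma ((k : ℝ) + ν + 1))

lemma besselI_eq_tsum (ν x : ℝ) : besselI ν x = ∑' k, besselTerm ν (x / 2) k := rfl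

lemma besselTerm_pos {ν t : ℝ} (hν : -1 < ν) (ht : 0 < t) (k : ℕ) : 0 < besselTerm ν t k := by
  have : (0 : ℝ) ≤ k := k.cast_nonneg
  have := Real.Gamma_pos_of_pos (show 0 < (k : ℝ) + ν + 1 by linarith)
  have := Real.rpow_pos_of_pos ht (2 * (k : ℝ) + ν)
  unfold besselTerm
  positivity

lemma besselTerm_order_succ {ν t : ℝ} (hν : -1 < ν) (ht : 0 < t) (k : ℕ) :
    besselTerm (ν + 1) t k * (k + ν + 1) = besselTerm ν t k * t := by
  have hk : (0 : ℝ) ≤ k := k.cast_nonneg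
  have hy : 0 < (k : ℝ) + ν + 1 := by linarith
  have hΓ := Real.Gamma_pos_of_pos hy
  unfold besselTerm
  rw [show (k : ℝ) + (ν + 1) + 1 = (k + ν + 1) + 1 by ring, Real.Gamma_add_one hy.ne',
    show 2 * (k : ℝ) + (ν + 1) = (2 * k + ν) + 1 by ring, Real.rpow_add_one ht.ne']
  field_simp

lemma besselTerm_index_succ {ν t : ℝ} (hν : -1 < ν) (ht : 0 < t) (k : ℕ) :
    besselTerm ν t (k + 1) * (k + 1) = besselTerm (ν + 1) t k * t := by
  have hk : (0 : ℝ) ≤ k := k.cast_nonneg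
  have hΓ := Real.Gamma_pos_of_pos (show 0 < (k : ℝ) + (ν + 1) + 1 by linarith)
  unfold besselTerm
  push_cast [Nat.factorial_succ]
  rw [show (k : ℝ) + 1 + ν + 1 = k + (ν + 1) + 1 by ring,
    show 2 * ((k : ℝ) + 1) + ν = (2 * k + (ν + 1)) + 1 by ring, Real.rpow_add_one ht.ne']
  field_simp

lemma summable_besselTerm {ν t : ℝ} (hν : -1 < ν) (ht : 0 < t) : Summable (besselTerm ν t) := by
  refine summable_of_ratio_test_tendsto_lt_one (l := 0) zero_lt_one
    (Eventually.of_forall fun k => (besselTerm_pos hν ht k).ne') ?_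
  have hratio : ∀ k : ℕ, ‖besselTerm ν t (k + 1)‖ / ‖besselTerm ν t k‖
      = t / (k + 1) * (t / (k + (ν + 1))) := by
    intro k
    have hk : (0 : ℝ) ≤ k := k.cast_nonneg
    have h0 := besselTerm_pos hν ht k
    have h1 := besselTerm_pos hν ht (k + 1)
    have hy : 0 < (k : ℝ) + (ν + 1) := by linarith
    rw [Real.norm_of_nonneg h0.le, Real.norm_of_nonneg h1.le]
    have e1 := besselTerm_order_succ hν ht k
    have e2 := besselTerm_index_succ hν ht k
    field_simp
    linear_combination (k + (ν + 1)) * e2 + t * e1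
  simp_rw [hratio]
  have hlim : ∀ c : ℝ, Tendsto (fun k : ℕ => t / ((k : ℝ) + c)) atTop (nhds 0) := fun c =>
    tendsto_const_nhds.div_atTop (tendsto_atTop_add_const_right _ _ tendsto_natCast_atTop_atTop)
  simpa using (hlim 1).mul (hlim (ν + 1))

lemma besselI_pos {ν x : ℝ} (hν : -1 < ν) (hx : 0 < x) : 0 < besselI ν x :=
  (summable_besselTerm hν (half_pos hx)).tsum_pos
    (fun k => (besselTerm_pos hν (half_pos hx) k).le) 0 (besselTerm_pos hν (half_pos hx) 0)

/-- The three-term recurrence `I_ν - I_{ν+2} = (2(ν+1)/x) I_{ν+1}`. -/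
lemma besselI_recurrence {ν x : ℝ} (hν : -1 < ν) (hx : 0 < x) :
    besselI ν x * (x / 2) =
      besselI (ν + 2) x * (x / 2) + (ν + 1) * besselI (ν + 1) x := by
  have ht := half_pos hx
  have h0 := summable_besselTerm hν ht
  have h1 := summable_besselTerm (show -1 < ν + 1 by linarith) ht
  have h2 := summable_besselTerm (show -1 < ν + 2 by linarith) ht
  have hk : ∀ k : ℕ, (k : ℝ) * besselTerm (ν + 1) (x / 2) k =
      besselTerm ν (x / 2) k * (x / 2) - (ν + 1) * besselTerm (ν + 1) (x / 2) k := fun k => by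
    linear_combination besselTerm_order_succ hν ht k
  have hs : Summable fun k : ℕ => (k : ℝ) * besselTerm (ν + 1) (x / 2) k := by
    simp_rw [hk]
    exact (h0.mul_right _).sub (h1.mul_left _)
  have hshift : ∑' k : ℕ, (k : ℝ) * besselTerm (ν + 1) (x / 2) k
      = ∑' k, besselTerm (ν + 2) (x / 2) k * (x / 2) := by
    rw [hs.tsum_eq_zero_add]
    simp only [Nat.cast_zero, zero_mul, zero_add]
    refine tsum_congr fun k => ?_
    have := besselTerm_index_succ (show -1 < ν + 1 by linarith) ht k
    rw [show ν + 1 + 1 = ν + 2 by ring] at this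
    push_cast
    linear_combination this
  simp_rw [hk] at hshift
  rw [(h0.mul_right _).tsum_sub (h1.mul_left _), tsum_mul_right, tsum_mul_left,
    tsum_mul_right] at hshift
  simp only [besselI_eq_tsum]
  linear_combination hshift

lemma besselI_add_one_le {ν x : ℝ} (hν : 0 ≤ ν) (hx : 0 < x) :
    besselI (ν + 1) x ≤ besselI ν x := by
  have ht := half_pos hx
  have h0 := summable_besselTerm (show -1 < ν by linarith) ht
  have h1 := summable_besselTerm (show -1 < ν + 1 by linarith) ht
  have h0' := (summable_nat_add_iff 1).2 h0
  have hterm : ∀ k, 2 * besselTerm (ν + 1) (x / 2) k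
      ≤ besselTerm ν (x / 2) k + besselTerm ν (x / 2) (k + 1) := by
    intro k
    have hk : (0 : ℝ) ≤ k := k.cast_nonneg
    have hA := besselTerm_pos (show -1 < ν + 1 by linarith) ht k
    have e1 := besselTerm_order_succ (show -1 < ν by linarith) ht k
    have e2 := besselTerm_index_succ (show -1 < ν by linarith) ht k
    generalize x / 2 = t at *
    generalize besselTerm (ν + 1) t k = A at *
    rw [← div_eq_iff ht.ne'] at e1
    rw [← eq_div_iff (by positivity)] at e2
    rw [← e1, e2, ← sub_nonneg]
    have : A * (k + ν + 1) / t + A * t / (k + 1) - 2 * A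
        = A * ((k + 1 - t) ^ 2 + ν * (k + 1)) / (t * (k + 1)) := by
      field_simp
      ring
    rw [this]
    positivity
  have hsum := (h1.mul_left 2).tsum_le_tsum hterm (h0.add h0')
  rw [tsum_mul_left, h0.tsum_add h0'] at hsum
  have hsplit := h0.tsum_eq_zero_add
  have hfirst := besselTerm_pos (show -1 < ν by linarith) ht 0
  simp only [besselI_eq_tsum]
  linarith

lemma besselI_add_two_le {ν x : ℝ} (hν : -1 < ν) (hx : 0 < x) :
    besselI (ν + 2) x ≤ besselI ν x := by
  have h := besselI_recurrence hν hx
  have h1 := besselI_pos (show -1 < ν + 1 by linarith) hx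
  refine le_of_mul_le_mul_right ?_ (half_pos hx)
  nlinarith

lemma besselI_le_add_one {ν x : ℝ} (hν : -1 < ν) (hx : 0 < x) :
    besselI ν x ≤ besselI (ν + 1) x * (1 + (ν + 1) / (x / 2)) := by
  have ht := half_pos hx
  have h := besselI_recurrence hν hx
  have h2 := besselI_add_one_le (show 0 ≤ ν + 1 by linarith) hx
  rw [show ν + 1 + 1 = ν + 2 by ring] at h2
  refine le_of_mul_le_mul_right ?_ ht
  rw [h, mul_assoc, one_add_mul (_ / _), div_mul_cancel₀ _ ht.ne']
  nlinarith

lemma besselI_add_one_le_mul {ν x : ℝ} (hν : -1 < ν) (hx : 0 < x) :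
    besselI (ν + 1) x ≤ x / 2 / (ν + 1) * besselI ν x := by
  have ht := half_pos hx
  have h0 := summable_besselTerm hν ht
  have h1 := summable_besselTerm (show -1 < ν + 1 by linarith) ht
  simp only [besselI_eq_tsum]
  rw [← tsum_mul_left]
  refine h1.tsum_le_tsum (fun k => ?_) (h0.mul_left _)
  have hk : (0 : ℝ) ≤ k := k.cast_nonneg
  have hA := besselTerm_pos (show -1 < ν + 1 by linarith) ht k
  have e1 := besselTerm_order_succ hν ht k
  rw [div_mul_eq_mul_div, le_div_iff₀ (by linarith)]
  nlinarith [mul_nonneg hA.le hk]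

lemma Gamma_add_one_le_mul_rpow {y θ : ℝ} (hy : 0 < y) (hθ0 : 0 < θ) (hθ1 : θ < 1) :
    Real.Gamma (y + 1) ≤ Real.Gamma (y + θ) * (y + θ) ^ (1 - θ) := by
  have hyθ : 0 < y + θ := by linarith
  have hΓ := Real.Gamma_pos_of_pos hyθ
  have h := Real.Gamma_mul_add_mul_le_rpow_Gamma_mul_rpow_Gamma hyθ
    (show 0 < y + θ + 1 by linarith) hθ0 (show 0 < 1 - θ by linarith) (by ring)
  rw [show θ * (y + θ) + (1 - θ) * (y + θ + 1) = y + 1 by ring, Real.Gamma_add_one hyθ.ne',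
    Real.mul_rpow hyθ.le hΓ.le] at h
  have hsplit : Real.Gamma (y + θ) ^ θ * Real.Gamma (y + θ) ^ (1 - θ) = Real.Gamma (y + θ) := by
    rw [← Real.rpow_add hΓ]
    simp
  calc _ ≤ _ := h
    _ = (Real.Gamma (y + θ) ^ θ * Real.Gamma (y + θ) ^ (1 - θ)) * (y + θ) ^ (1 - θ) := by ring
    _ = _ := by rw [hsplit]

lemma besselTerm_add_le {ν θ t : ℝ} (hν : -1 < ν) (hθ0 : 0 < θ) (hθ1 : θ < 1) (ht : 0 < t)
    (k : ℕ) :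
    besselTerm (ν + θ) t k
      ≤ (1 - θ) * besselTerm ν t k + (θ + 1 / t) * besselTerm (ν + 1) t k := by
  have hk : (0 : ℝ) ≤ k := k.cast_nonneg
  have hA := besselTerm_pos (show -1 < ν + 1 by linarith) ht k
  have e1 := besselTerm_order_succ hν ht k
  rw [← div_eq_iff ht.ne'] at e1
  set y : ℝ := k + ν + 1 with hydef
  have hy : 0 < y := by linarith
  have hyθ : 0 < y + θ := by linarith
  have hΓθ := Real.Gamma_pos_of_pos hyθ
  have hΓ1 := Real.Gamma_pos_of_pos (show 0 < y + 1 by linarith)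
  have hG := Gamma_add_one_le_mul_rpow hy hθ0 hθ1
  have hAG := Real.geom_mean_le_arith_mean2_weighted hθ0.le (show 0 ≤ 1 - θ by linarith) ht.le
    hyθ.le (by ring)
  have hle : besselTerm (ν + θ) t k
      ≤ besselTerm (ν + 1) t k / t * (t ^ θ * (y + θ) ^ (1 - θ)) := by
    unfold besselTerm
    rw [show (k : ℝ) + (ν + θ) + 1 = y + θ by rw [hydef]; ring,
      show (k : ℝ) + (ν + 1) + 1 = y + 1 by rw [hydef]; ring,
      show 2 * (k : ℝ) + (ν + 1) = (2 * k + ν) + 1 by ring, Real.rpow_add_one ht.ne',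
      show 2 * (k : ℝ) + (ν + θ) = (2 * k + ν) + θ by ring, Real.rpow_add ht]
    have hp := Real.rpow_pos_of_pos ht (2 * (k : ℝ) + ν)
    have hq := Real.rpow_pos_of_pos ht θ
    have hf : (0 : ℝ) < k.factorial := by exact_mod_cast k.factorial_pos
    generalize t ^ (2 * (k : ℝ) + ν) = p at *
    rw [show p * t / (k.factorial * Real.Gamma (y + 1)) / t * (t ^ θ * (y + θ) ^ (1 - θ))
      = p * t ^ θ * (y + θ) ^ (1 - θ) / (k.factorial * Real.Gamma (y + 1)) by field_simp,
      div_le_div_iff₀ (by positivity) (by positivity)]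
    calc p * t ^ θ * (k.factorial * Real.Gamma (y + 1))
        ≤ p * t ^ θ * (k.factorial * (Real.Gamma (y + θ) * (y + θ) ^ (1 - θ))) := by gcongr
      _ = _ := by ring
  refine hle.trans ?_
  rw [← e1]
  calc besselTerm (ν + 1) t k / t * (t ^ θ * (y + θ) ^ (1 - θ))
      ≤ besselTerm (ν + 1) t k / t * (θ * t + (1 - θ) * (y + θ)) := by gcongr
    _ ≤ besselTerm (ν + 1) t k / t * (θ * t + (1 - θ) * y + 1) :=
        mul_le_mul_of_nonneg_left (by nlinarith) (by positivity)
    _ = _ := by field_simp; ring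

/-- Up to a factor `1 + O(1/x)`, `I_ν` decreases when `ν` grows by less than one. -/
lemma besselI_add_le {ν θ x : ℝ} (hν : 0 ≤ ν) (hθ0 : 0 < θ) (hθ1 : θ < 1) (hx : 0 < x) :
    besselI (ν + θ) x ≤ besselI ν x * (1 + 1 / (x / 2)) := by
  have ht := half_pos hx
  have h0 := summable_besselTerm (show -1 < ν by linarith) ht
  have h1 := summable_besselTerm (show -1 < ν + 1 by linarith) ht
  have hθ := summable_besselTerm (show -1 < ν + θ by linarith) ht
  have hsum := hθ.tsum_le_tsum (besselTerm_add_le (by linarith) hθ0 hθ1 ht)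
    ((h0.mul_left (1 - θ)).add (h1.mul_left (θ + 1 / (x / 2))))
  rw [(h0.mul_left _).tsum_add (h1.mul_left _), tsum_mul_left, tsum_mul_left] at hsum
  simp only [← besselI_eq_tsum] at hsum
  have hc : 0 ≤ θ + 1 / (x / 2) := by positivity
  nlinarith [mul_le_mul_of_nonneg_left (besselI_add_one_le hν hx) hc]

lemma besselI_ratio_le {s x : ℝ} (hs0 : 0 < s) (hs1 : s < 1 / 2) (hx : 0 < x) :
    besselI (1 - s) x / besselI (s - 1) x ≤ (1 + 2 / (x / 2)) ^ 2 := by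
  have ht := half_pos hx
  rw [div_le_iff₀ (besselI_pos (by linarith) hx)]
  have h1 := besselI_add_le hs0.le (show 0 < 1 - 2 * s by linarith) (by linarith) hx
  have h2 := besselI_le_add_one (show -1 < s by linarith) hx
  have h3 := besselI_add_two_le (show -1 < s - 1 by linarith) hx
  rw [show s + (1 - 2 * s) = 1 - s by ring] at h1
  rw [show s - 1 + 2 = s + 1 by ring] at h3
  have hI := besselI_pos (show -1 < s - 1 by linarith) hx
  calc besselI (1 - s) x ≤ besselI s x * (1 + 1 / (x / 2)) := h1
    _ ≤ (besselI (s - 1) x * (1 + (s + 1) / (x / 2))) * (1 + 1 / (x / 2)) := by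
        gcongr
        exact h2.trans (by gcongr)
    _ ≤ (besselI (s - 1) x * (1 + 2 / (x / 2))) * (1 + 2 / (x / 2)) := by
        gcongr <;> linarith
    _ = _ := by ring

lemma le_besselI_ratio {s x : ℝ} (hs0 : 0 < s) (hs1 : s < 1 / 2) (hx : 0 < x) :
    ((1 + 2 / (x / 2)) ^ 3)⁻¹ ≤ besselI (1 - s) x / besselI (s - 1) x := by
  have ht := half_pos hx
  rw [le_div_iff₀ (besselI_pos (by linarith) hx), inv_mul_le_iff₀ (by positivity)]
  have h1 := besselI_add_le (show 0 ≤ 1 - s by linarith) (show 0 < 2 * s by linarith)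
    (by linarith) hx
  have h2 := besselI_le_add_one (show -1 < s by linarith) hx
  have h3 := besselI_le_add_one (show -1 < s - 1 by linarith) hx
  rw [show 1 - s + 2 * s = s + 1 by ring] at h1
  rw [show s - 1 + 1 = s by ring] at h3
  have hI := besselI_pos (show -1 < 1 - s by linarith) hx
  calc besselI (s - 1) x ≤ besselI s x * (1 + s / (x / 2)) := h3
    _ ≤ (besselI (1 - s) x * (1 + 1 / (x / 2)) * (1 + (s + 1) / (x / 2)))
        * (1 + s / (x / 2)) := by
        gcongr
        exact h2.trans (by gcongr)
    _ ≤ (besselI (1 - s) x * (1 + 2 / (x / 2)) * (1 + 2 / (x / 2)))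
        * (1 + 2 / (x / 2)) := by
        gcongr <;> linarith
    _ = _ := by ring

lemma tendsto_besselI_ratio {s : ℝ} (hs0 : 0 < s) (hs1 : s < 1 / 2) :
    Tendsto (fun x => besselI (1 - s) x / besselI (s - 1) x) atTop (nhds 1) := by
  have hlim : Tendsto (fun x : ℝ => 1 + 2 / (x / 2)) atTop (nhds 1) := by
    simpa using (tendsto_const_nhds (x := (1 : ℝ))).add
      ((tendsto_const_nhds (x := (2 : ℝ))).div_atTop (tendsto_id.atTop_div_const two_pos))
  refine tendsto_of_tendsto_of_tendsto_of_le_of_le' (by simpa using (hlim.pow 3).inv₀ (by simp))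
    (by simpa using hlim.pow 2) ?_ ?_
  · filter_upwards [eventually_gt_atTop 0] with x hx using le_besselI_ratio hs0 hs1 hx
  · filter_upwards [eventually_gt_atTop 0] with x hx using besselI_ratio_le hs0 hs1 hx

lemma besselI_ratio_le_const {s x : ℝ} (hs0 : 0 < s) (hs1 : s < 1 / 2) (hx : 0 < x) :
    besselI (1 - s) x / besselI (s - 1) x ≤ 2 / s + 9 := by
  have ht := half_pos hx
  rcases le_total (x / 2) 1 with h | h
  · have h1 := besselI_add_le hs0.le (show 0 < 1 - 2 * s by linarith) (by linarith) hx
    have h2 := besselI_add_one_le_mul (show -1 < s - 1 by linarith) hx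
    rw [show s + (1 - 2 * s) = 1 - s by ring] at h1
    rw [show s - 1 + 1 = s by ring] at h2
    have hI := besselI_pos (show -1 < s - 1 by linarith) hx
    rw [div_le_iff₀ hI]
    calc besselI (1 - s) x ≤ besselI s x * (1 + 1 / (x / 2)) := h1
      _ ≤ (x / 2 / s * besselI (s - 1) x) * (1 + 1 / (x / 2)) := by gcongr
      _ = (x / 2 + 1) / s * besselI (s - 1) x := by field_simp
      _ ≤ 2 / s * besselI (s - 1) x := by gcongr; linarith
      _ ≤ _ := by gcongr; linarith
  · have h2 : 2 / (x / 2) ≤ 2 := div_le_self zero_le_two h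
    calc _ ≤ (1 + 2 / (x / 2)) ^ 2 := besselI_ratio_le hs0 hs1 hx
      _ ≤ (1 + 2) ^ 2 := by gcongr
      _ ≤ 2 / s + 9 := by linarith [div_pos two_pos hs0]

lemma aemeasurable_besselI_abs {ν : ℝ} (hν : -1 < ν) :
    AEMeasurable (fun ξ : ℝ => besselI ν |ξ|) := by
  refine aemeasurable_of_tendsto_metrizable_ae atTop
    (f := fun (n : ℕ) ξ => ∑ k ∈ Finset.range n, besselTerm ν (|ξ| / 2) k) (fun n => ?_) ?_
  · unfold besselTerm
    fun_prop
  · filter_upwards [Measure.ae_ne volume (0 : ℝ)] with ξ hξ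
    exact (summable_besselTerm hν (half_pos (abs_pos.2 hξ))).hasSum.tendsto_sum_nat

lemma Cs_pos {s : ℝ} (hs0 : 0 < s) (hs1 : s < 1 / 2) : 0 < Cs s := by
  have := Real.Gamma_pos_of_pos hs0
  have := Real.Gamma_pos_of_pos (show 0 < 1 - s by linarith)
  unfold Cs
  positivity

lemma Stilde1_eq {s ξ : ℝ} (hξ : ξ ≠ 0) :
    Stilde1 s ξ = Cs s * (besselI (1 - s) |ξ| / besselI (s - 1) |ξ|) := by
  rw [Stilde1, if_neg hξ, mul_div_assoc]

lemma aestronglyMeasurable_Stilde1 {s : ℝ} (hs0 : 0 < s) (hs1 : s < 1 / 2) :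
    AEStronglyMeasurable (Stilde1 s) := by
  refine AEMeasurable.aestronglyMeasurable (AEMeasurable.congr (f := fun ξ : ℝ =>
    Cs s * (besselI (1 - s) |ξ| / besselI (s - 1) |ξ|)) ?_ ?_)
  · exact ((aemeasurable_besselI_abs (by linarith)).div
      (aemeasurable_besselI_abs (by linarith))).const_mul _
  · filter_upwards [Measure.ae_ne volume (0 : ℝ)] with ξ hξ using (Stilde1_eq hξ).symm

lemma abs_Stilde1_le {s : ℝ} (hs0 : 0 < s) (hs1 : s < 1 / 2) (ξ : ℝ) :
    |Stilde1 s ξ| ≤ Cs s * (2 / s + 9) := by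
  have hC := Cs_pos hs0 hs1
  rcases eq_or_ne ξ 0 with rfl | hξ
  · rw [Stilde1, if_pos rfl, abs_zero]
    positivity
  · have hx := abs_pos.2 hξ
    have h1 := besselI_pos (show -1 < 1 - s by linarith) hx
    have h2 := besselI_pos (show -1 < s - 1 by linarith) hx
    rw [Stilde1_eq hξ, abs_of_pos (by positivity)]
    gcongr
    exact besselI_ratio_le_const hs0 hs1 hx

lemma integrable_sin_sq_div_rpow {p : ℝ} (hp1 : 1 < p) (hp2 : p ≤ 2) :
    Integrable (fun η : ℝ => (Real.sin η) ^ 2 / |η| ^ p) := by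
  have hdom := (integrable_one_add_norm (E := ℝ) (μ := volume) (r := p)
    (by simpa using hp1)).const_mul (2 ^ p)
  refine hdom.mono' (Measurable.aestronglyMeasurable (by fun_prop)) ?_
  filter_upwards [Measure.ae_ne volume (0 : ℝ)] with η hη
  have hx := abs_pos.2 hη
  rw [Real.norm_of_nonneg (by positivity), Real.norm_eq_abs, Real.rpow_neg (by positivity),
    ← div_eq_mul_inv, div_le_div_iff₀ (by positivity) (by positivity),
    ← Real.mul_rpow zero_le_two hx.le]
  rcases le_total |η| 1 with h | h
  · have hsin : Real.sin η ^ 2 ≤ |η| ^ p := by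
      calc Real.sin η ^ 2 ≤ |η| ^ 2 := sq_le_sq' (by
              linarith [neg_abs_le (Real.sin η), Real.abs_sin_le_abs (x := η)])
              ((le_abs_self _).trans Real.abs_sin_le_abs)
        _ = |η| ^ (2 : ℝ) := by norm_cast
        _ ≤ |η| ^ p := Real.rpow_le_rpow_of_exponent_ge hx h hp2
    rw [mul_comm 2, Real.mul_rpow hx.le zero_le_two]
    gcongr
    linarith
  · calc Real.sin η ^ 2 * (1 + |η|) ^ p ≤ 1 * (2 * |η|) ^ p := by
          gcongr
          · exact Real.sin_sq_le_one η
          · linarith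
      _ = _ := one_mul _

lemma integral_sin_sq_div_rpow_pos {p : ℝ} (hp1 : 1 < p) (hp2 : p ≤ 2) :
    0 < ∫ η : ℝ, (Real.sin η) ^ 2 / |η| ^ p := by
  rw [integral_pos_iff_support_of_nonneg (fun η => by positivity)
    (integrable_sin_sq_div_rpow hp1 hp2)]
  refine lt_of_lt_of_le (b := volume (Set.Ioo (0 : ℝ) 1)) (by simp) (measure_mono ?_)
  rintro η ⟨h0, h1⟩
  have hsin := Real.sin_pos_of_pos_of_lt_pi h0 (by linarith [Real.pi_gt_three])
  have hpow := Real.rpow_pos_of_pos (abs_pos.2 h0.ne') p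
  exact (div_pos (pow_pos hsin 2) hpow).ne'

lemma Ts_div_rpow {s r : ℝ} (hr : 0 < r) :
    Ts s r / r ^ (1 - 2 * s)
      = ∫ η : ℝ, 4 * Stilde1 s (r⁻¹ * η) * ((Real.sin η) ^ 2 / |η| ^ (2 - 2 * s)) := by
  have hcv := Measure.integral_comp_mul_left
    (fun ξ : ℝ => symbolS1 s ξ * (4 * (Real.sin (r * ξ)) ^ 2 / ξ ^ 2)) r⁻¹
  rw [inv_inv, abs_of_pos hr, smul_eq_mul] at hcv
  have hTs : Ts s r / r ^ (1 - 2 * s) = r⁻¹ * (r ^ (1 - 2 * s))⁻¹ * (r * Ts s r) := by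
    field_simp
  rw [hTs, Ts, ← hcv, ← integral_const_mul]
  refine integral_congr_ae ?_
  filter_upwards [Measure.ae_ne volume (0 : ℝ)] with η hη
  have hx := abs_pos.2 hη
  simp only [symbolS1]
  rw [mul_inv_cancel_left₀ hr.ne', abs_mul, abs_of_pos (inv_pos.2 hr),
    Real.mul_rpow (by positivity) hx.le, Real.inv_rpow hr.le, Real.rpow_sub hr,
    Real.rpow_sub hx, Real.rpow_one, mul_pow, ← sq_abs η, show (2 : ℝ) = ((2 : ℕ) : ℝ) by norm_num,
    Real.rpow_natCast]
  have h1 := Real.rpow_pos_of_pos hr (2 * s)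
  have h2 := Real.rpow_pos_of_pos hx (2 * s)
  push_cast
  field_simp

/-- Proposition 1.4, behavior at `0`: `T_s(r)/r^{1-2s} → 4 C_s ∫_ℝ sin²η/|η|^{2-2s} dη` as
`r → 0⁺`, a finite positive constant depending only on `s`; for small `r` the quantity
`T_s(r)` behaves like the fractional `s`-perimeter `r^{1-2s}` of an interval. -/
theorem stmt13 (s : ℝ) (hs : s ∈ Set.Ioo (0 : ℝ) (1 / 2)) :
    Tendsto (fun r : ℝ => Ts s r / r ^ (1 - 2 * s)) (nhdsWithin 0 (Set.Ioi 0))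
      (nhds (4 * Cs s * ∫ η : ℝ, (Real.sin η) ^ 2 / |η| ^ (2 - 2 * s))) ∧
    Integrable (fun η : ℝ => (Real.sin η) ^ 2 / |η| ^ (2 - 2 * s)) ∧
    0 < 4 * Cs s * ∫ η : ℝ, (Real.sin η) ^ 2 / |η| ^ (2 - 2 * s) := by
  obtain ⟨hs0, hs1⟩ := hs
  have hint := integrable_sin_sq_div_rpow (show 1 < 2 - 2 * s by linarith) (by linarith)
  have hpos := integral_sin_sq_div_rpow_pos (show 1 < 2 - 2 * s by linarith) (by linarith)
  have hC := Cs_pos hs0 hs1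
  refine ⟨?_, hint, by positivity⟩
  rw [← integral_const_mul]
  refine Tendsto.congr' (f₁ := fun r : ℝ => ∫ η : ℝ,
    4 * Stilde1 s (r⁻¹ * η) * ((Real.sin η) ^ 2 / |η| ^ (2 - 2 * s))) ?_ ?_
  · filter_upwards [self_mem_nhdsWithin] with r hr using (Ts_div_rpow hr).symm
  refine tendsto_integral_filter_of_dominated_convergence
    (fun η => 4 * (Cs s * (2 / s + 9)) * ((Real.sin η) ^ 2 / |η| ^ (2 - 2 * s))) ?_ ?_
    (hint.const_mul _) ?_
  · filter_upwards [self_mem_nhdsWithin] with r hr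
    have hq := Measure.quasiMeasurePreserving_smul (volume : Measure ℝ)
      (inv_ne_zero (ne_of_gt hr))
    exact (((aestronglyMeasurable_Stilde1 hs0 hs1).comp_quasiMeasurePreserving
      hq).const_mul 4).mul hint.aestronglyMeasurable
  · refine Eventually.of_forall fun r => Eventually.of_forall fun η => ?_
    rw [norm_mul, norm_mul, Real.norm_of_nonneg (show (0 : ℝ) ≤ 4 by norm_num), Real.norm_eq_abs,
      Real.norm_of_nonneg (by positivity : 0 ≤ (Real.sin η) ^ 2 / |η| ^ (2 - 2 * s))]
    gcongr
    exact abs_Stilde1_le hs0 hs1 _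
  · filter_upwards [Measure.ae_ne volume (0 : ℝ)] with η hη
    refine Tendsto.mul_const _ (Tendsto.const_mul 4 ?_)
    have harg : Tendsto (fun r : ℝ => r⁻¹ * |η|) (nhdsWithin 0 (Set.Ioi 0)) atTop :=
      tendsto_inv_nhdsGT_zero.atTop_mul_const (abs_pos.2 hη)
    have hlim := ((tendsto_besselI_ratio hs0 hs1).comp harg).const_mul (Cs s)
    rw [mul_one] at hlim
    refine hlim.congr' ?_
    filter_upwards [self_mem_nhdsWithin] with r hr
    have hr' : (0 : ℝ) < r⁻¹ := inv_pos.2 hr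
    rw [Stilde1_eq (mul_ne_zero hr'.ne' hη), abs_mul, abs_of_pos hr', Function.comp_apply]
end
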